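/- arXiv:1908.08448 — 3 statements merged into one kernel-verified Lean document; each statement's English description precedes it below -/
import Mathlib

section
/- Let t ≥ 1, n ≥ 2t+1, and set k = gcd(n,t). If n/k is even then wt((0,t)_n) = N((0,t)_n) = 2^(n−1) − 2^(n/2 + k − 1). If n/k is odd then wt((0,t)_n) = 2^(n−1) and N((0,t)_n) = 2^(n−1) − 2^((n+k−2)/2). -/
/-- The monomial rotation symmetric quadratic function `(0,t)_n`:
`x ↦ ∑_{j=0}^{n-1} x_j * x_{(j+t) mod n}` over `ZMod 2`. -/
def mrs (n t : ℕ) (x : Fin n → ZMod 2) : ZMod 2 :=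
  ∑ j : Fin n, x j * x ⟨(j.val + t) % n, Nat.mod_lt _ j.pos⟩

/-- Hamming weight of a Boolean function in `n` variables. -/
noncomputable def wtB {n : ℕ} (f : (Fin n → ZMod 2) → ZMod 2) : ℕ :=
  Nat.card {x : Fin n → ZMod 2 // f x = 1}

/-- Nonlinearity: the minimum Hamming distance from `f` to an affine function. -/
noncomputable def nonlin {n : ℕ} (f : (Fin n → ZMod 2) → ZMod 2) : ℕ :=
  sInf {d : ℕ | ∃ (w : Fin n → ZMod 2) (b : ZMod 2),
    d = Nat.card {x : Fin n → ZMod 2 // f x ≠ b + ∑ i : Fin n, w i * x i}}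

open Finset

/-- The sign character on `ZMod 2`. -/
def sgn2 (a : ZMod 2) : ℤ := if a = 0 then 1 else -1

lemma sgn2_add (a b : ZMod 2) : sgn2 (a + b) = sgn2 a * sgn2 b := by
  revert a b; decide

lemma sgn2_zero : sgn2 0 = 1 := by decide

lemma sgn2_sum_linear {V : Type*} [AddCommGroup V] [Fintype V] (L : V → ZMod 2)
    (hL : ∀ u v, L (u + v) = L u + L v) (u : V) (hu : L u ≠ 0) : ∑ v, sgn2 (L v) = 0 := by
  have h := Equiv.sum_comp (Equiv.addRight u) (fun v => sgn2 (L v))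
  have hu1 : L u = 1 := by
    generalize L u = z at hu; revert z; decide
  simp only [Equiv.coe_addRight, hL, hu1, sgn2_add] at h
  rw [← Finset.sum_mul] at h
  have : sgn2 1 = -1 := by decide
  rw [this] at h
  linarith

lemma two_z (a : ZMod 2) : a + a = 0 := by revert a; decide

section General
variable {G : Type*} [Fintype G] [DecidableEq G]

/-- The cyclic quadratic form attached to a permutation. -/
def qf (σ : Equiv.Perm G) (x : G → ZMod 2) : ZMod 2 := ∑ j, x j * x (σ j)

/-- The polar form. -/
def bf (σ : Equiv.Perm G) (x a : G → ZMod 2) : ZMod 2 := ∑ j, x j * (a (σ j) + a (σ.symm j))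

/-- Walsh transform. -/
def wal (σ : Equiv.Perm G) (w : G → ZMod 2) : ℤ := ∑ x, sgn2 (qf σ x + ∑ i, w i * x i)

lemma qf_add (σ : Equiv.Perm G) (x a : G → ZMod 2) :
    qf σ (x + a) = qf σ x + qf σ a + bf σ x a := by
  have h : ∑ j, x j * a (σ.symm j) = ∑ j, a j * x (σ j) := by
    rw [← Equiv.sum_comp σ]
    simp [mul_comm]
  simp only [qf, bf, mul_add, Finset.sum_add_distrib, h, Pi.add_apply, add_mul]
  ring

lemma bf_add (σ : Equiv.Perm G) (a x y : G → ZMod 2) :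
    bf σ (x + y) a = bf σ x a + bf σ y a := by
  simp [bf, add_mul, Finset.sum_add_distrib]

/-- The radical. -/
def rad (σ : Equiv.Perm G) : Finset (G → ZMod 2) := {a | ∀ j, a (σ (σ j)) = a j}

lemma bf_rad (σ : Equiv.Perm G) {a : G → ZMod 2} (ha : a ∈ rad σ) (x : G → ZMod 2) :
    bf σ x a = 0 := by
  simp only [rad, Finset.mem_filter, Finset.mem_univ, true_and] at ha
  refine Finset.sum_eq_zero fun j _ => ?_
  have := ha (σ.symm j)
  rw [Equiv.apply_symm_apply] at this
  rw [this, two_z, mul_zero]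

lemma bf_not_rad (σ : Equiv.Perm G) {a : G → ZMod 2} (ha : a ∉ rad σ) :
    ∃ x, bf σ x a ≠ 0 := by
  simp only [rad, Finset.mem_filter, Finset.mem_univ, true_and, not_forall] at ha
  obtain ⟨j, hj⟩ := ha
  refine ⟨Pi.single (σ j) 1, ?_⟩
  simp only [bf, Pi.single_apply, ite_mul, one_mul, zero_mul, Finset.sum_ite_eq',
    Finset.mem_univ, if_true, Equiv.symm_apply_apply]
  generalize a (σ (σ j)) = p at *
  generalize a j = q at *
  revert p q; decide

lemma wal_sq (σ : Equiv.Perm G) (w : G → ZMod 2) :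
    wal σ w ^ 2 = 2 ^ Fintype.card G * ∑ a ∈ rad σ, sgn2 (qf σ a + ∑ i, w i * a i) := by
  have h1 : wal σ w ^ 2 = ∑ a : G → ZMod 2, ∑ x : G → ZMod 2,
      sgn2 (qf σ a + ∑ i, w i * a i) * sgn2 (bf σ x a) := by
    have e : wal σ w ^ 2 = ∑ x : G → ZMod 2, sgn2 (qf σ x + ∑ i, w i * x i) * wal σ w := by
      rw [← Finset.sum_mul, sq]; rfl
    rw [e, Finset.sum_comm]
    refine Finset.sum_congr rfl fun x _ => ?_
    rw [wal, ← Equiv.sum_comp (Equiv.addLeft x), Finset.mul_sum]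
    refine Finset.sum_congr rfl fun a _ => ?_
    rw [← sgn2_add, ← sgn2_add, Equiv.coe_addLeft, qf_add]
    congr 1
    simp only [Pi.add_apply, mul_add, Finset.sum_add_distrib]
    have e1 := two_z (qf σ x)
    have e2 := two_z (∑ i, w i * x i)
    linear_combination e1 + e2
  rw [h1, Finset.mul_sum, ← Finset.sum_subset (Finset.subset_univ (rad σ))]
  · refine Finset.sum_congr rfl fun a ha => ?_
    simp [bf_rad σ ha, sgn2_zero, mul_comm]
  · intro a _ ha
    obtain ⟨u, hu⟩ := bf_not_rad σ ha
    rw [← Finset.mul_sum, sgn2_sum_linear (fun x => bf σ x a) (fun x y => bf_add σ a x y) u hu,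
      mul_zero]

lemma wal_sq_le (σ : Equiv.Perm G) (w : G → ZMod 2) :
    wal σ w ^ 2 ≤ 2 ^ Fintype.card G * ((rad σ).card : ℤ) := by
  rw [wal_sq]
  gcongr
  rw [Finset.card_eq_sum_ones]
  push_cast
  gcongr
  unfold sgn2; split_ifs <;> norm_num

lemma wal_sq_eq (σ : Equiv.Perm G) (w : G → ZMod 2)
    (h : ∀ a ∈ rad σ, qf σ a + ∑ i, w i * a i = 0) :
    wal σ w ^ 2 = 2 ^ Fintype.card G * ((rad σ).card : ℤ) := by
  rw [wal_sq, Finset.sum_congr rfl (fun a ha => by rw [h a ha, sgn2_zero])]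
  simp

lemma wal_zero_eq_zero (σ : Equiv.Perm G) (a : G → ZMod 2) (ha : a ∈ rad σ) (h : qf σ a = 1) :
    wal σ 0 = 0 := by
  have e := Equiv.sum_comp (Equiv.addRight a) (fun x => sgn2 (qf σ x))
  have e0 : wal σ 0 = ∑ x, sgn2 (qf σ x) := by simp [wal]
  simp only [Equiv.coe_addRight, qf_add, bf_rad σ ha, h, add_zero, sgn2_add] at e
  rw [← Finset.sum_mul, ← e0] at e
  have : sgn2 1 = -1 := by decide
  rw [this] at e
  linarith

lemma qf_rad_color (σ : Equiv.Perm G) (c : G → ZMod 2) (hc : ∀ j, c (σ j) = c j + 1)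
    (a : G → ZMod 2) (ha : a ∈ rad σ) : qf σ a = 0 := by
  simp only [rad, Finset.mem_filter, Finset.mem_univ, true_and] at ha
  have h1 : qf σ a = ∑ j, a j * a (σ j) * c j + ∑ j, a j * a (σ j) * c (σ j) := by
    rw [qf, ← Finset.sum_add_distrib]
    refine Finset.sum_congr rfl fun j _ => ?_
    rw [hc, ← mul_add, ← add_assoc, two_z, zero_add, mul_one]
  have h2 : ∑ j, a j * a (σ j) * c j = ∑ j, a j * a (σ j) * c (σ j) := by
    rw [← Equiv.sum_comp σ]
    refine Finset.sum_congr rfl fun j _ => ?_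
    rw [ha]; ring
  rw [h1, h2, two_z]

lemma color_mul (z : ZMod 2) : z * (z + 1) = 0 := by revert z; decide

lemma qf_mask (σ : Equiv.Perm G) (c : G → ZMod 2) (hc : ∀ j, c (σ j) = c j + 1)
    (u : G → ZMod 2) : qf σ (c * u) = 0 := by
  refine Finset.sum_eq_zero fun j _ => ?_
  simp only [Pi.mul_apply, hc]
  linear_combination (u j * u (σ j)) * color_mul (c j)

lemma bf_comm (σ : Equiv.Perm G) (x y : G → ZMod 2) : bf σ x y = bf σ y x := by
  have h1 := qf_add σ x y
  have h2 := qf_add σ y x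
  rw [add_comm y x] at h2
  linear_combination h2 - h1

lemma bf_self (σ : Equiv.Perm G) (x : G → ZMod 2) : bf σ x x = 0 := by
  have h := qf_add σ x x
  have h0 : x + x = 0 := by ext j; exact two_z _
  rw [h0, two_z, zero_add] at h
  rw [← h]; simp [qf]

lemma wal_zero_nonneg (σ : Equiv.Perm G) (c : G → ZMod 2) (hc : ∀ j, c (σ j) = c j + 1) :
    0 ≤ wal σ 0 := by
  have e0 : wal σ 0 = ∑ x, sgn2 (qf σ x) := by simp [wal]
  have h1 : (2 ^ Fintype.card G : ℤ) * wal σ 0 = ∑ x : G → ZMod 2, ∑ u : G → ZMod 2,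
      sgn2 (qf σ x) * sgn2 (bf σ (c * u) x) := by
    rw [Finset.sum_comm]
    have : ∀ u : G → ZMod 2, ∑ x : G → ZMod 2, sgn2 (qf σ x) * sgn2 (bf σ (c * u) x)
        = wal σ 0 := by
      intro u
      rw [e0, ← Equiv.sum_comp (Equiv.addRight (c * u)) (fun x => sgn2 (qf σ x))]
      refine Finset.sum_congr rfl fun x _ => ?_
      rw [Equiv.coe_addRight, qf_add, qf_mask σ c hc, add_zero, sgn2_add, bf_comm]
    simp [this]
  have h2 : 0 ≤ (2 ^ Fintype.card G : ℤ) * wal σ 0 := by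
    rw [h1]
    refine Finset.sum_nonneg fun x _ => ?_
    rw [← Finset.mul_sum]
    by_cases hx : ∃ u, bf σ (c * u) x ≠ 0
    · obtain ⟨u, hu⟩ := hx
      rw [sgn2_sum_linear (fun u => bf σ (c * u) x)
        (fun u v => by rw [mul_add, bf_add]) u hu, mul_zero]
    · push Not at hx
      have hq : qf σ x = 0 := by
        have hc' : ∀ j, (1 + c) (σ j) = (1 + c) j + 1 := by
          intro j; simp [hc]; ring
        have hdec : x = c * x + (1 + c) * x := by
          ext j
          simp only [Pi.add_apply, Pi.mul_apply, Pi.one_apply]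
          linear_combination -(two_z (c j * x j))
        have h3 : bf σ (c * x) x = bf σ (c * x) (c * x) + bf σ (c * x) ((1 + c) * x) := by
          conv_lhs => rw [bf_comm, hdec, bf_add]
          rw [← hdec, bf_comm, bf_comm σ ((1+c)*x)]
        rw [hx, bf_self, zero_add] at h3
        rw [hdec, qf_add, qf_mask σ c hc, qf_mask σ _ hc', ← h3]; rfl
      simp [hx, hq, sgn2_zero]
  exact nonneg_of_mul_nonneg_right h2 (by positivity)

end General

lemma card_ne {V : Type*} [Fintype V] (f g : V → ZMod 2) :
    2 * (Nat.card {x // f x ≠ g x} : ℤ) = Fintype.card V - ∑ x, sgn2 (f x + g x) := by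
  classical
  rw [Nat.card_eq_fintype_card, Fintype.card_subtype, Finset.card_filter]
  have : (Fintype.card V : ℤ) = ∑ x : V, 1 := by simp
  rw [this, ← Finset.sum_sub_distrib]
  push_cast
  rw [Finset.mul_sum]
  refine Finset.sum_congr rfl fun x _ => ?_
  generalize f x = p
  generalize g x = q
  revert p q; decide

/-- Rotation by `t`. -/
noncomputable def rotP (n t : ℕ) : Equiv.Perm (Fin n) :=
  Equiv.ofBijective (fun j => ⟨(j.val + t) % n, Nat.mod_lt _ j.pos⟩) (by
    rw [← Finite.injective_iff_bijective]
    intro i j h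
    simp only [Fin.mk.injEq] at h
    have h' : i.val + t ≡ j.val + t [MOD n] := h
    have := Nat.ModEq.add_right_cancel' t h'
    exact Fin.ext (Nat.ModEq.eq_of_lt_of_lt this i.2 j.2))

lemma rotP_apply (n t : ℕ) (j : Fin n) :
    rotP n t j = ⟨(j.val + t) % n, Nat.mod_lt _ j.pos⟩ := rfl

lemma mrs_eq (n t : ℕ) : mrs n t = qf (rotP n t) := rfl

lemma periodic_gcd (n s : ℕ) (hn : 0 < n) (a : Fin n → ZMod 2)
    (h : ∀ j : Fin n, a ⟨(j.val + s) % n, Nat.mod_lt _ hn⟩ = a j) (m m' : ℕ)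
    (hm : m ≡ m' [MOD (Nat.gcd n s)]) :
    a ⟨m % n, Nat.mod_lt _ hn⟩ = a ⟨m' % n, Nat.mod_lt _ hn⟩ := by
  set A : ℕ → ZMod 2 := fun m => a ⟨m % n, Nat.mod_lt _ hn⟩ with hA
  have hAm : ∀ p q, p ≡ q [MOD n] → A p = A q := by
    intro p q hpq
    have : p % n = q % n := hpq
    simp only [hA, this]
  have hs : ∀ p, A (p + s) = A p := by
    intro p
    have := h ⟨p % n, Nat.mod_lt _ hn⟩
    simpa [hA] using this
  have hus : ∀ u p, A (p + s * u) = A p := by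
    intro u
    induction u with
    | zero => simp
    | succ u ih => intro p; rw [mul_add, mul_one, ← add_assoc, hs, ih]
  have hg : ∀ p, A (p + Nat.gcd n s) = A p := by
    intro p
    obtain ⟨u, hu⟩ : ∃ u, s * u ≡ Nat.gcd n s [MOD n] := by
      rw [Nat.gcd_comm]
      rcases lt_or_ge (Nat.gcd s n) n with h1 | h1
      · obtain ⟨u, -, hu⟩ := Nat.exists_mul_mod_eq_gcd h1
        exact ⟨u, by rw [Nat.ModEq, hu, Nat.mod_eq_of_lt h1]⟩
      · refine ⟨0, ?_⟩
        have : Nat.gcd s n = n := le_antisymm (Nat.gcd_le_right _ hn) h1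
        rw [this]; simp [Nat.ModEq]
    rw [← hus u p]
    exact hAm _ _ (Nat.ModEq.add_left p hu.symm)
  have hp : Function.Periodic A (Nat.gcd n s) := hg
  have e1 := hp.map_mod_nat m
  have e2 := hp.map_mod_nat m'
  have hm' : m % Nat.gcd n s = m' % Nat.gcd n s := hm
  show A m = A m'
  rw [← e1, ← e2, hm']

lemma card_periodic (n s : ℕ) (hn : 0 < n) :
    (Finset.univ.filter (fun a : Fin n → ZMod 2 =>
      ∀ j : Fin n, a ⟨(j.val + s) % n, Nat.mod_lt _ hn⟩ = a j)).card = 2 ^ Nat.gcd n s := by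
  have hg : 0 < Nat.gcd n s := Nat.gcd_pos_of_pos_left _ hn
  have hgn : Nat.gcd n s ≤ n := Nat.gcd_le_left _ hn
  have : (2 : ℕ) ^ Nat.gcd n s = (Finset.univ : Finset (Fin (Nat.gcd n s) → ZMod 2)).card := by
    simp
  rw [this]
  symm
  refine Finset.card_bij (fun b _ => fun j => b ⟨j.val % Nat.gcd n s, Nat.mod_lt _ hg⟩) ?_ ?_ ?_
  · intro b _
    simp only [Finset.mem_filter, Finset.mem_univ, true_and]
    intro j
    congr 2
    rw [Nat.mod_mod_of_dvd _ (Nat.gcd_dvd_left n s)]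
    obtain ⟨q, hq⟩ := Nat.gcd_dvd_right n s
    have h0 : Nat.gcd n s * q % Nat.gcd n s = 0 := Nat.mul_mod_right _ _
    rw [← hq] at h0
    rw [Nat.add_mod, h0, add_zero, Nat.mod_mod]
  · intro b _ b' _ hbb
    ext i
    have := congrFun hbb ⟨i.val, lt_of_lt_of_le i.2 hgn⟩
    simp only [Nat.mod_eq_of_lt i.2] at this
    rw [this]
  · intro a ha
    simp only [Finset.mem_filter, Finset.mem_univ, true_and] at ha
    refine ⟨fun i => a ⟨i.val, lt_of_lt_of_le i.2 hgn⟩, Finset.mem_univ _, ?_⟩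
    funext j
    have := periodic_gcd n s hn a ha (j.val % Nat.gcd n s) j.val (Nat.mod_modEq _ _)
    have h1 : j.val % Nat.gcd n s % n = j.val % Nat.gcd n s :=
      Nat.mod_eq_of_lt (lt_of_lt_of_le (Nat.mod_lt _ hg) hgn)
    simpa [h1, Nat.mod_eq_of_lt j.2] using this

lemma mem_rad_rotP (n t : ℕ) (hn : 0 < n) (a : Fin n → ZMod 2) :
    a ∈ rad (rotP n t) ↔
      ∀ j : Fin n, a ⟨(j.val + 2 * t) % n, Nat.mod_lt _ hn⟩ = a j := by
  simp only [rad, Finset.mem_filter, Finset.mem_univ, true_and, rotP_apply]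
  simp [two_mul, add_assoc]

lemma card_rad (n t : ℕ) (hn : 0 < n) : (rad (rotP n t)).card = 2 ^ Nat.gcd n (2 * t) := by
  rw [← card_periodic n (2 * t) hn]
  congr 1
  ext a
  rw [mem_rad_rotP n t hn]
  simp

lemma dist_eq (n t : ℕ) (w : Fin n → ZMod 2) (b : ZMod 2) :
    2 * (Nat.card {x : Fin n → ZMod 2 // mrs n t x ≠ b + ∑ i : Fin n, w i * x i} : ℤ)
      = 2 ^ n - sgn2 b * wal (rotP n t) w := by
  rw [card_ne (mrs n t) (fun x => b + ∑ i : Fin n, w i * x i), mrs_eq, wal, Finset.mul_sum]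
  congr 1
  · simp
  · refine Finset.sum_congr rfl fun x _ => ?_
    rw [← sgn2_add]; congr 1; ring

lemma wt_eq (n t : ℕ) : 2 * (wtB (mrs n t) : ℤ) = 2 ^ n - wal (rotP n t) 0 := by
  have h := dist_eq n t 0 0
  rw [sgn2_zero, one_mul] at h
  rw [← h, wtB]
  congr 2
  refine Nat.card_congr (Equiv.subtypeEquivRight fun x => ?_)
  simp only [Pi.zero_apply, zero_mul, Finset.sum_const_zero, add_zero]
  generalize mrs n t x = z
  revert z; decide

lemma two_pow_sub (n e : ℕ) (hn : 0 < n) (he : e + 1 ≤ n) (d : ℕ)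
    (h : 2 * (d : ℤ) = 2 ^ n - 2 ^ (e + 1)) : d = 2 ^ (n - 1) - 2 ^ e := by
  obtain ⟨m, rfl⟩ : ∃ m, n = m + 1 := ⟨n - 1, by omega⟩
  have hle : 2 ^ e ≤ 2 ^ m := Nat.pow_le_pow_right (by norm_num) (by omega)
  simp only [Nat.add_sub_cancel]
  zify [hle]
  rw [pow_succ, pow_succ] at h
  linarith

lemma nonlin_eq (n t e : ℕ) (hn : 0 < n) (he : e + 1 ≤ n)
    (hd : n + Nat.gcd n (2 * t) = 2 * (e + 1)) (w : Fin n → ZMod 2)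
    (h : ∀ a ∈ rad (rotP n t), qf (rotP n t) a + ∑ i, w i * a i = 0) :
    (wal (rotP n t) w = 2 ^ (e + 1) ∨ wal (rotP n t) w = - 2 ^ (e + 1)) ∧
    nonlin (mrs n t) = 2 ^ (n - 1) - 2 ^ e := by
  have hM : (2 : ℤ) ^ Fintype.card (Fin n) * ((rad (rotP n t)).card : ℤ) = (2 ^ (e + 1)) ^ 2 := by
    rw [card_rad n t hn, Fintype.card_fin]
    push_cast
    rw [← pow_add, hd, ← pow_mul, mul_comm]
  have h1 := wal_sq_eq (rotP n t) w h
  rw [hM] at h1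
  have h2 := sq_eq_sq_iff_eq_or_eq_neg.mp h1
  refine ⟨h2, ?_⟩
  have hle : 2 ^ e ≤ 2 ^ (n - 1) := Nat.pow_le_pow_right (by norm_num) (by omega)
  apply le_antisymm
  · apply Nat.sInf_le
    rcases h2 with h2 | h2
    · refine ⟨w, 0, (two_pow_sub n e hn he _ ?_).symm⟩
      rw [dist_eq, h2, sgn2_zero, one_mul]
    · refine ⟨w, 1, (two_pow_sub n e hn he _ ?_).symm⟩
      rw [dist_eq, h2, show sgn2 1 = -1 by decide]
      ring
  · refine le_csInf ⟨_, w, 0, rfl⟩ ?_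
    rintro d ⟨v, b, rfl⟩
    have h3 := dist_eq n t v b
    have h4 := wal_sq_le (rotP n t) v
    rw [hM] at h4
    have h5 := abs_le_of_sq_le_sq' h4 (by positivity)
    have h6 : sgn2 b * wal (rotP n t) v ≤ 2 ^ (e + 1) := by
      unfold sgn2; split_ifs <;> linarith [h5.1, h5.2]
    have h7 : (2 : ℤ) ^ n = 2 * 2 ^ (n - 1) := by
      rw [← pow_succ']; congr 1; omega
    zify [hle]
    rw [pow_succ] at h6
    linarith

lemma gcd_two (n t : ℕ) (hn : 0 < n) :
    Nat.gcd n (2 * t) = Nat.gcd n t * Nat.gcd (n / Nat.gcd n t) 2 := by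
  have hg : 0 < Nat.gcd n t := Nat.gcd_pos_of_pos_left _ hn
  obtain ⟨g, m, s, h, hc, e1, e2⟩ : ∃ g m s : ℕ, 0 < g ∧ Nat.Coprime m s ∧ n = m * g ∧ t = s * g := by
    obtain ⟨m, s, hc, h1, h2⟩ := Nat.exists_coprime n t
    exact ⟨_, m, s, hg, hc, h1, h2⟩
  subst e1 e2
  rw [Nat.gcd_mul_right, hc.gcd_eq_one, one_mul, Nat.mul_div_cancel _ h, ← mul_assoc,
    Nat.gcd_mul_right, mul_comm, Nat.Coprime.gcd_mul_right_cancel_right 2 hc.symm]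

/-- Weight and nonlinearity of the quadratic MRS functions `(0,t)_n`. -/
theorem mrs_weight_nonlinearity (t n : ℕ) (ht : 1 ≤ t) (hn : 2 * t + 1 ≤ n)
    (k : ℕ) (hk : k = Nat.gcd n t) :
    (Even (n / k) →
      wtB (mrs n t) = 2 ^ (n - 1) - 2 ^ (n / 2 + k - 1) ∧
      nonlin (mrs n t) = 2 ^ (n - 1) - 2 ^ (n / 2 + k - 1)) ∧
    (Odd (n / k) →
      wtB (mrs n t) = 2 ^ (n - 1) ∧
      nonlin (mrs n t) = 2 ^ (n - 1) - 2 ^ ((n + k - 2) / 2)) := by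
  have hn0 : 0 < n := by omega
  have hk0 : 0 < k := hk ▸ Nat.gcd_pos_of_pos_left _ hn0
  have hkt : k ≤ t := hk ▸ Nat.gcd_le_right _ ht
  obtain ⟨m, hm⟩ : k ∣ n := hk ▸ Nat.gcd_dvd_left n t
  obtain ⟨s, hs⟩ : k ∣ t := hk ▸ Nat.gcd_dvd_right n t
  have hnk : n / k = m := by rw [hm, Nat.mul_div_cancel_left _ hk0]
  have hG := gcd_two n t hn0
  rw [← hk, hnk] at hG
  rw [hnk]
  constructor
  · intro hev
    have hG2 : Nat.gcd m 2 = 2 := Nat.gcd_eq_right hev.two_dvd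
    rw [hG2] at hG
    obtain ⟨r, hr⟩ := hev
    have hn2 : n = 2 * (k * r) := by rw [hm, hr]; ring
    have hsodd : s % 2 = 1 := by
      by_contra hcon
      have h2s : 2 ∣ s := by omega
      have h1 : k * 2 ∣ Nat.gcd n t := Nat.dvd_gcd
        (hm ▸ Nat.mul_dvd_mul_left k ⟨r, by omega⟩) (hs ▸ Nat.mul_dvd_mul_left k h2s)
      rw [← hk] at h1
      have := Nat.le_of_dvd hk0 h1
      omega
    -- the colouring
    let c : Fin n → ZMod 2 := fun j => ((j.val / k : ℕ) : ZMod 2)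
    have hc : ∀ j, c (rotP n t j) = c j + 1 := by
      intro j
      simp only [c, rotP_apply]
      have h1 : (j.val + t) / k = j.val / k + s := by
        rw [hs, Nat.add_mul_div_left _ _ hk0]
      have h2 : (j.val + t) / k = (j.val + t) % n / k + m * ((j.val + t) / n) := by
        conv_lhs => rw [← Nat.mod_add_div (j.val + t) n]
        rw [← Nat.add_mul_div_left _ _ hk0, ← mul_assoc, ← hm]
      have h3 : (j.val + t) % n / k + 2 * (r * ((j.val + t) / n)) = j.val / k + s := by
        rw [← h1, h2, hr]; ring
      have h4 := congrArg (Nat.cast : ℕ → ZMod 2) h3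
      have hs1 : (s : ZMod 2) = 1 := by
        rw [← ZMod.natCast_mod, hsodd]; rfl
      push_cast at h4
      rw [hs1, show (2 : ZMod 2) = 0 from rfl] at h4
      simpa using h4
    have hr1 : k + k * 2 ≤ n + k := by
      have : 1 < m := by
        by_contra hcon
        have : m ≤ 1 := by omega
        have := Nat.mul_le_mul_left k this
        omega
      have := Nat.mul_le_mul_left k this
      omega
    obtain ⟨h1, h2⟩ := nonlin_eq n t (n / 2 + k - 1) hn0 (by omega) (by omega) 0
      (fun a ha => by simp [qf_rad_color _ c hc a ha])
    refine ⟨?_, h2⟩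
    apply two_pow_sub n _ hn0 (by omega)
    rw [wt_eq]
    have h3 := wal_zero_nonneg _ c hc
    have h4 : (0:ℤ) < 2 ^ (n / 2 + k - 1 + 1) := by positivity
    rcases h1 with h1 | h1
    · rw [h1]
    · linarith
  · intro hodd
    have hG2 : Nat.gcd m 2 = 1 := (Nat.coprime_two_right).mpr hodd
    rw [hG2, mul_one] at hG
    obtain ⟨r, hr⟩ := hodd
    have hn2 : n = 2 * (k * r) + k := by rw [hm, hr]; ring
    have hinv : ∀ a ∈ rad (rotP n t), ∀ j, a (rotP n t j) = a j := by
      intro a ha j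
      rw [mem_rad_rotP n t hn0] at ha
      have := periodic_gcd n (2 * t) hn0 a ha (j.val + t) j.val (by
        rw [hG, hs]; simp [Nat.ModEq])
      simpa [rotP_apply, Nat.mod_eq_of_lt j.2] using this
    have hsq : ∀ z : ZMod 2, z * z = z := by decide
    have hq : ∀ a ∈ rad (rotP n t), qf (rotP n t) a = ∑ j, a j := by
      intro a ha
      refine Finset.sum_congr rfl fun j _ => ?_
      rw [hinv a ha, hsq]
    constructor
    · have hw : wal (rotP n t) 0 = 0 := by
        let a : Fin n → ZMod 2 := fun j => if k ∣ j.val then 1 else 0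
        have ha : a ∈ rad (rotP n t) := by
          rw [mem_rad_rotP n t hn0]
          intro j
          have : k ∣ (j.val + 2 * t) % n ↔ k ∣ j.val := by
            rw [Nat.dvd_mod_iff ⟨m, hm⟩]
            exact Nat.dvd_add_left (Dvd.dvd.mul_left ⟨s, hs⟩ 2)
          simp only [a, this]
        refine wal_zero_eq_zero _ a ha ?_
        rw [hq a ha]
        have h1 : ∑ j, a j = ∑ j ∈ Finset.range n, if k ∣ j then (1 : ZMod 2) else 0 :=
          Fin.sum_univ_eq_sum_range (fun j => if k ∣ j then (1 : ZMod 2) else 0) n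
        have h2 : ((Finset.range n).filter (fun j => k ∣ j)).card = m := by
          rw [← Finset.card_range m]
          symm
          refine Finset.card_bij (fun i _ => k * i) ?_ ?_ ?_
          · intro i hi
            simp only [Finset.mem_range, Finset.mem_filter] at hi ⊢
            exact ⟨hm ▸ Nat.mul_lt_mul_of_pos_left hi hk0, dvd_mul_right _ _⟩
          · intro i _ i' _ h
            exact Nat.eq_of_mul_eq_mul_left hk0 h
          · intro j hj
            simp only [Finset.mem_range, Finset.mem_filter] at hj
            obtain ⟨h1, i, rfl⟩ := hj
            rw [hm] at h1
            exact ⟨i, Finset.mem_range.mpr (Nat.lt_of_mul_lt_mul_left h1), rfl⟩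
        rw [h1, Finset.sum_boole, h2, hr]
        push_cast
        rw [show (2 : ZMod 2) = 0 from rfl]; simp
      have h1 := wt_eq n t
      rw [hw, sub_zero] at h1
      have h7 : (2 : ℤ) ^ n = 2 * 2 ^ (n - 1) := by
        rw [← pow_succ']; congr 1; omega
      zify
      linarith
    · refine (nonlin_eq n t ((n + k - 2) / 2) hn0 (by omega) (by omega) 1 ?_).2
      intro a ha
      rw [hq a ha]
      simp only [Pi.one_apply, one_mul, two_z]
end

section
/- Let S be a nonempty finite set of positive integers with |S| odd, and for each n ≥ 1 let Q_n : GaloisField 2 n → ZMod 2 be Q_n(x) = Tr(∑_{i∈S} x^(2^i+1)). Then there exists an integer c ≥ 1 such that for all n ≥ 1, Q_n is balanced if and only if 2^c does not divide n. -/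
/-- The quadratic trace function `Q_n(x) = Tr(∑_{i∈S} x^(2^i+1))` on `GaloisField 2 n`. -/
noncomputable def Qtr (S : Finset ℕ) (n : ℕ) (x : GaloisField 2 n) : ZMod 2 :=
  Algebra.trace (ZMod 2) (GaloisField 2 n) (∑ i ∈ S, x ^ (2 ^ i + 1))

/-- `g` is balanced if it takes the value `1` exactly `2^(n-1)` times. -/
noncomputable def BalancedG (n : ℕ) (g : GaloisField 2 n → ZMod 2) : Prop :=
  Nat.card {x : GaloisField 2 n // g x = 1} = 2 ^ (n - 1)

open Polynomial

/-- the linearised operator of the radical -/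
def LL {K : Type*} [CommRing K] (S : Finset ℕ) (N : ℕ) (x : K) : K :=
  ∑ i ∈ S, (x ^ (2 ^ (N + i)) + x ^ (2 ^ (N - i)))

/-- explicit trace -/
def TT {K : Type*} [CommRing K] (n : ℕ) (y : K) : K := ∑ j ∈ Finset.range n, y ^ (2 ^ j)

/-- the quadratic expression -/
def qq {K : Type*} [CommRing K] (S : Finset ℕ) (x : K) : K := ∑ i ∈ S, x ^ (2 ^ i + 1)

section gauss

/-- sign character -/
def chi (a : ZMod 2) : ℤ := if a = 0 then 1 else -1

lemma chi_add (a b : ZMod 2) : chi (a + b) = chi a * chi b := by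
  revert a b; decide

lemma sum_chi {F : Type*} [Fintype F] (Q : F → ZMod 2) :
    ∑ x, chi (Q x) = (Fintype.card F : ℤ) - 2 * Nat.card {x // Q x = 1} := by
  classical
  have h : ∀ x, chi (Q x) = 1 - 2 * (if Q x = 1 then 1 else 0 : ℤ) := by
    intro x
    generalize Q x = a
    revert a; decide
  simp_rw [h]
  rw [Finset.sum_sub_distrib, ← Finset.mul_sum, Finset.sum_boole]
  simp [Fintype.card_subtype]

lemma balanced_iff {F : Type*} [Fintype F] [AddCommGroup F] (Q : F → ZMod 2)
    (B : F → F →+ ZMod 2) (hQ : ∀ w x, Q (w + x) = Q w + Q x + B w x) :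
    (∑ x, chi (Q x) = 0) ↔ ∃ w, (∀ x, B w x = 0) ∧ Q w = 1 := by
  classical
  constructor
  · intro h
    by_contra hne
    push Not at hne
    have hin : ∀ w, ∑ x, chi (B w x) = if (∀ x, B w x = 0) then (Fintype.card F : ℤ) else 0 := by
      intro w
      split_ifs with hw
      · simp [hw, chi]
      · push Not at hw
        obtain ⟨x0, hx0⟩ := hw
        have h1 : B w x0 = 1 := by
          revert hx0; generalize B w x0 = a; revert a; decide
        have h2 : ∑ x, chi (B w x) = ∑ x, chi (B w (x + x0)) :=
          (Equiv.sum_comp (Equiv.addRight x0) (fun x => chi (B w x))).symm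
        have h3 : ∑ x, chi (B w (x + x0)) = - ∑ x, chi (B w x) := by
          rw [← Finset.sum_neg_distrib]
          refine Finset.sum_congr rfl fun x _ => ?_
          rw [map_add, h1, chi_add]; simp [chi]
        linarith
    have hsq : (∑ x, chi (Q x)) * (∑ x, chi (Q x)) = ∑ w, chi (Q w) * ∑ x, chi (B w x) := by
      calc (∑ x, chi (Q x)) * (∑ x, chi (Q x))
          = ∑ x, ∑ w, chi (Q x) * chi (Q w) := Finset.sum_mul_sum _ _ _ _
        _ = ∑ x, ∑ w, chi (Q x) * chi (Q (w + x)) := by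
            refine Finset.sum_congr rfl fun x _ => ?_
            exact (Equiv.sum_comp (Equiv.addRight x) (fun w => chi (Q x) * chi (Q w))).symm
        _ = ∑ w, ∑ x, chi (Q x) * chi (Q (w + x)) := Finset.sum_comm
        _ = _ := by
            refine Finset.sum_congr rfl fun w _ => ?_
            rw [Finset.mul_sum]
            refine Finset.sum_congr rfl fun x _ => ?_
            rw [hQ, chi_add, chi_add]
            have : chi (Q x) * chi (Q x) = 1 := by
              generalize Q x = a; revert a; decide
            linear_combination (chi (Q w) * chi (B w x)) * this
    rw [h] at hsq
    have hnn : ∀ w ∈ Finset.univ, 0 ≤ chi (Q w) * ∑ x, chi (B w x) := by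
      intro w _
      rw [hin]
      split_ifs with hw
      · have : chi (Q w) = 1 := by
          have := hne w hw
          revert this; generalize Q w = a; revert a; decide
        rw [this]; positivity
      · simp
    have h0 := (Finset.sum_eq_zero_iff_of_nonneg hnn).1 (by rw [← hsq]; simp) 0 (Finset.mem_univ _)
    have hB0 : ∀ x, B 0 x = 0 := by
      intro x
      have h1 := hQ 0 x
      have h2 := hQ 0 0
      rw [map_zero, add_zero] at h2
      rw [zero_add] at h1
      have h3 : Q 0 = 0 := by simpa using h2
      rw [h3] at h1; simpa using h1
    rw [hin, if_pos hB0] at h0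
    have : (Fintype.card F : ℤ) ≠ 0 := by
      exact_mod_cast Fintype.card_ne_zero
    have h5 : chi (Q 0) ≠ 0 := by
      generalize Q 0 = a; revert a; decide
    exact mul_ne_zero h5 this h0
  · rintro ⟨w, hw, hq⟩
    have h2 : ∑ x, chi (Q x) = ∑ x, chi (Q (w + x)) :=
      (Equiv.sum_comp (Equiv.addLeft w) (fun x => chi (Q x))).symm
    have h3 : ∑ x, chi (Q (w + x)) = - ∑ x, chi (Q x) := by
      rw [← Finset.sum_neg_distrib]
      refine Finset.sum_congr rfl fun x _ => ?_
      rw [hQ, hw, hq, add_zero, chi_add, show chi 1 = -1 from rfl, neg_one_mul]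
    linarith

end gauss

section field

set_option linter.unusedSectionVars false

variable {F : Type*} [Field F] [Finite F] [Algebra (ZMod 2) F] [CharP F 2]

lemma tr_sq (y : F) : Algebra.trace (ZMod 2) F (y ^ 2) = Algebra.trace (ZMod 2) F y := by
  have := Algebra.trace_eq_of_algEquiv (FiniteField.frobeniusAlgEquivOfAlgebraic (ZMod 2) F) y
  rw [← this]
  simp

lemma tr_pow (y : F) (j : ℕ) :
    Algebra.trace (ZMod 2) F (y ^ (2 ^ j)) = Algebra.trace (ZMod 2) F y := by
  induction j with
  | zero => simp
  | succ j ih => rw [pow_succ, pow_mul, tr_sq, ih]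

lemma polar (S : Finset ℕ) (N : ℕ) (hN : ∀ i ∈ S, i ≤ N) (x y : F) :
    Algebra.trace (ZMod 2) F (qq S (x + y)) =
      Algebra.trace (ZMod 2) F (qq S x) + Algebra.trace (ZMod 2) F (qq S y) +
      Algebra.trace (ZMod 2) F (LL S N x * y ^ (2 ^ N)) := by
  unfold qq LL
  rw [Finset.sum_mul]
  simp only [map_sum]
  rw [← Finset.sum_add_distrib, ← Finset.sum_add_distrib]
  refine Finset.sum_congr rfl fun i hi => ?_
  have h1 : (x + y) ^ (2 ^ i + 1) = x ^ (2 ^ i + 1) + y ^ (2 ^ i + 1) +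
      (x ^ (2 ^ i) * y + x * y ^ (2 ^ i)) := by
    rw [pow_succ, add_pow_char_pow]; ring
  have h2 := tr_pow (x ^ (2 ^ i) * y) N
  have h3 := tr_pow (x * y ^ (2 ^ i)) (N - i)
  rw [h1, map_add, map_add, map_add, ← h2, ← h3, add_mul, map_add, mul_pow, mul_pow, ← pow_mul,
    ← pow_mul, ← pow_add, ← pow_add, Nat.add_sub_cancel' (hN i hi), add_comm i N]

lemma rad_iff (S : Finset ℕ) (N : ℕ) (w : F) :
    (∀ y : F, Algebra.trace (ZMod 2) F (LL S N w * y ^ (2 ^ N)) = 0) ↔ LL S N w = 0 := by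
  constructor
  · intro h
    by_contra hne
    obtain ⟨z, hz⟩ := Algebra.trace_surjective (ZMod 2) F 1
    obtain ⟨y, hy⟩ : ∃ y : F, y ^ (2 ^ N) = z / LL S N w := by
      have : Function.Injective (fun y : F => y ^ (2 ^ N)) := by
        have := iterateFrobenius_inj F 2 N
        intro a b hab
        exact this (by simpa [iterateFrobenius_def] using hab)
      exact (Finite.surjective_of_injective this) _
    have := h y
    rw [hy, mul_div_cancel₀ _ hne, hz] at this
    exact one_ne_zero this
  · intro h y
    simp [h]

lemma LL_add (S : Finset ℕ) (N : ℕ) (x y : F) : LL S N (x + y) = LL S N x + LL S N y := by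
  unfold LL
  rw [← Finset.sum_add_distrib]
  refine Finset.sum_congr rfl fun i _ => ?_
  rw [add_pow_char_pow, add_pow_char_pow]; ring

lemma LL_pow (S : Finset ℕ) (N : ℕ) (x : F) (j : ℕ) :
    LL S N (x ^ (2 ^ j)) = (LL S N x) ^ (2 ^ j) := by
  unfold LL
  rw [sum_pow_char_pow]
  refine Finset.sum_congr rfl fun i _ => ?_
  rw [add_pow_char_pow, ← pow_mul, ← pow_mul, ← pow_mul, ← pow_mul, mul_comm (2 ^ j),
    mul_comm (2 ^ j)]

lemma qq_pow (S : Finset ℕ) (x : F) (j : ℕ) : qq S (x ^ (2 ^ j)) = (qq S x) ^ (2 ^ j) := by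
  unfold qq
  rw [sum_pow_char_pow]
  refine Finset.sum_congr rfl fun i _ => ?_
  rw [← pow_mul, ← pow_mul, mul_comm (2 ^ j)]

lemma descend (S : Finset ℕ) (N : ℕ) (hN : ∀ i ∈ S, i ≤ N) (M m : ℕ) (w : F)
    (hw : LL S N w = 0) :
    LL S N (∑ j ∈ Finset.range m, w ^ (2 ^ (M * j))) = 0 ∧
    Algebra.trace (ZMod 2) F (qq S (∑ j ∈ Finset.range m, w ^ (2 ^ (M * j)))) =
      m * Algebra.trace (ZMod 2) F (qq S w) := by
  induction m with
  | zero => simp [LL, qq]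
  | succ m ih =>
    obtain ⟨h1, h2⟩ := ih
    rw [Finset.sum_range_succ]
    constructor
    · rw [LL_add, h1, LL_pow, hw]; simp
    · rw [polar S N hN, h1, h2, qq_pow, tr_pow]
      push_cast
      simp; ring

lemma descend_fix (M m : ℕ) (w : F) (hw : w ^ (2 ^ (M * m)) = w) :
    (∑ j ∈ Finset.range m, w ^ (2 ^ (M * j))) ^ (2 ^ M) =
      ∑ j ∈ Finset.range m, w ^ (2 ^ (M * j)) := by
  rw [sum_pow_char_pow]
  have h : ∀ j, (w ^ (2 ^ (M * j))) ^ (2 ^ M) = w ^ (2 ^ (M * (j + 1))) := by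
    intro j
    rw [← pow_mul, ← pow_add, mul_add, mul_one]
  simp_rw [h]
  have h1 := Finset.sum_range_succ (fun j => w ^ (2 ^ (M * j))) m
  rw [Finset.sum_range_succ'] at h1
  rw [hw] at h1
  simpa using h1

end field

section shift

/-- shift on sequences -/
def sh (A : Type*) [AddCommGroup A] [Module (ZMod 2) A] : Module.End (ZMod 2) (ℕ → A) :=
  LinearMap.funLeft (ZMod 2) A Nat.succ

variable {A : Type*} [AddCommGroup A] [Module (ZMod 2) A]

lemma sh_pow (k : ℕ) (h : ℕ → A) (j : ℕ) : ((sh A) ^ k) h j = h (j + k) := by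
  induction k generalizing j with
  | zero => simp
  | succ k ih =>
    rw [pow_succ', Module.End.mul_apply]
    change ((sh A ^ k) h) (j + 1) = _
    rw [ih]; congr 1; ring

/-- the polynomial of the radical -/
noncomputable def ell (S : Finset ℕ) (N : ℕ) : (ZMod 2)[X] :=
  ∑ i ∈ S, (X ^ (N + i) + X ^ (N - i))

lemma aeval_ell (S : Finset ℕ) (N : ℕ) (h : ℕ → A) (j : ℕ) :
    (aeval (sh A) (ell S N) h) j = ∑ i ∈ S, (h (j + (N + i)) + h (j + (N - i))) := by
  unfold ell
  simp [LinearMap.sum_apply, Finset.sum_apply, sh_pow]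

lemma kill (S : Finset ℕ) (N : ℕ) (p : (ZMod 2)[X]) (hp : p ∣ ell S N) (h : ℕ → A)
    (hh : aeval (sh A) p h = 0) (j : ℕ) :
    ∑ i ∈ S, (h (j + (N + i)) + h (j + (N - i))) = 0 := by
  obtain ⟨g, hg⟩ := hp
  rw [← aeval_ell, hg, mul_comm, map_mul, Module.End.mul_apply, hh]
  simp

lemma ell_ne_zero (S : Finset ℕ) (N : ℕ) (hS : S.Nonempty) (hpos : ∀ i ∈ S, 1 ≤ i) :
    ell S N ≠ 0 := by
  obtain ⟨i0, hi0⟩ := hS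
  intro h
  have h1 : (ell S N).coeff (N + i0) = 1 := by
    unfold ell
    rw [finsetSum_coeff, Finset.sum_eq_single i0]
    · have := hpos i0 hi0
      rw [coeff_add, coeff_X_pow, coeff_X_pow, if_pos rfl, if_neg (by omega), add_zero]
    · intro i hi hne
      have := hpos i0 hi0
      rw [coeff_add, coeff_X_pow, coeff_X_pow, if_neg (by omega), if_neg (by omega), add_zero]
    · exact fun h => absurd hi0 h
  rw [h] at h1
  simp at h1

lemma X_add_one_pow (e : ℕ) : ((X : (ZMod 2)[X]) + 1) ^ (2 ^ e) = X ^ (2 ^ e) + 1 := by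
  rw [add_pow_char_pow, one_pow]

lemma odd_count (S : Finset ℕ) (N : ℕ) (hN : ∀ i ∈ S, i ≤ N) (hpos : ∀ i ∈ S, 1 ≤ i)
    (hodd : Odd S.card) (e : ℕ) (hd : ((X : (ZMod 2)[X]) + 1) ^ (2 ^ e + 1) ∣ ell S N) :
    ((S.filter (fun i => 2 ^ e ∣ i)).card : ZMod 2) = 1 := by
  set M := 2 ^ e with hM
  have hMpos : 0 < M := by positivity
  have h2 : ∀ a : ZMod 2, a + a = 0 := by decide
  have h := kill S N _ hd (fun k => ((k / M : ℕ) : ZMod 2)) (by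
    rw [pow_succ, hM, X_add_one_pow, ← hM]
    funext j
    simp only [map_mul, map_add, map_pow, aeval_X, map_one, Module.End.mul_apply,
      LinearMap.add_apply, Module.End.one_apply, Pi.add_apply, sh_pow, Pi.zero_apply]
    have h1 : (sh (ZMod 2)) (fun k => ((k / M : ℕ) : ZMod 2)) = fun k => (((k+1) / M : ℕ) : ZMod 2) := rfl
    rw [h1]
    simp only []
    rw [show j + M + 1 = (j + 1) + M by ring, Nat.add_div_right _ hMpos, Nat.add_div_right _ hMpos]
    push_cast
    linear_combination h2 (((j + 1) / M : ℕ) : ZMod 2) + h2 ((j / M : ℕ) : ZMod 2) + h2 1)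
    (M * N - N)
  have hterm : ∀ i ∈ S, ((((M * N - N + (N + i)) / M : ℕ) : ZMod 2) +
      (((M * N - N + (N - i)) / M : ℕ) : ZMod 2)) = if M ∣ i then 0 else 1 := by
    intro i hi
    have hiN := hN i hi
    have hip := hpos i hi
    have hMN : N ≤ M * N := Nat.le_mul_of_pos_left _ hMpos
    rw [show M * N - N + (N + i) = i + M * N by omega,
      show M * N - N + (N - i) = M * N - i by omega, Nat.add_mul_div_left _ _ hMpos]
    have hdm := Nat.div_add_mod i M
    have hlt := Nat.mod_lt i hMpos
    set q := i / M
    set r := i % M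
    have hq : q ≤ M * q := Nat.le_mul_of_pos_left _ hMpos
    split_ifs with hdv
    · have hr : r = 0 := Nat.mod_eq_zero_of_dvd hdv
      have : M * N - i = M * (N - q) := by rw [Nat.mul_sub]; omega
      rw [this, Nat.mul_div_cancel_left _ hMpos, ← Nat.cast_add,
        show q + N + (N - q) = N + N by omega, Nat.cast_add, h2]
    · have hr : r ≠ 0 := fun h => hdv (Nat.dvd_of_mod_eq_zero h)
      have : M * N - i = (M - r) + M * (N - q - 1) := by
        have h5 : M * (N - q - 1) = M * N - M * q - M := by
          rw [Nat.mul_sub, Nat.mul_sub, mul_one]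
        have h6 : M * (q + 1) ≤ M * N := Nat.mul_le_mul_left _ (by omega)
        rw [mul_add] at h6
        omega
      rw [this, Nat.add_mul_div_left _ _ hMpos, Nat.div_eq_of_lt (by omega), ← Nat.cast_add,
        show q + N + (0 + (N - q - 1)) = (N - 1) + (N - 1) + 1 by omega, Nat.cast_add,
        Nat.cast_add, h2]
      simp
  rw [Finset.sum_congr rfl hterm] at h
  have h7 : ∑ i ∈ S, ((if M ∣ i then 0 else 1 : ZMod 2)) +
      ∑ i ∈ S, ((if M ∣ i then 1 else 0 : ZMod 2)) = S.card := by
    rw [← Finset.sum_add_distrib, Finset.card_eq_sum_ones, Nat.cast_sum]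
    refine Finset.sum_congr rfl fun i _ => ?_
    split_ifs <;> simp
  rw [h, zero_add, Finset.sum_boole] at h7
  rw [h7]
  exact (ZMod.natCast_eq_one_iff_odd).2 hodd

end shift

section closure

/-- the algebraic closure of the prime field -/
abbrev Om := AlgebraicClosure (ZMod 2)

/-- existence of a radical vector of nonzero value, inside the algebraic closure -/
def BO (S : Finset ℕ) (N n : ℕ) : Prop :=
  ∃ x : Om, x ^ (2 ^ n) = x ∧ LL S N x = 0 ∧ TT n (qq S x) ≠ 0

instance : CharP Om 2 := charP_of_injective_algebraMap (algebraMap (ZMod 2) Om).injective 2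

lemma om_two : (2 : Om) = 0 := by exact_mod_cast CharP.cast_eq_zero Om 2

lemma pow_fix {x : Om} {M : ℕ} (hx : x ^ (2 ^ M) = x) (k : ℕ) : x ^ (2 ^ (M * k)) = x := by
  induction k with
  | zero => simp
  | succ k ih => rw [mul_add, mul_one, pow_add, pow_mul, ih, hx]

lemma TT_mul {y : Om} {M : ℕ} (hy : y ^ (2 ^ M) = y) (m : ℕ) :
    TT (M * m) y = m * TT M y := by
  induction m with
  | zero => simp [TT]
  | succ m ih =>
    have : TT (M * (m + 1)) y = TT (M * m) y + TT M y := by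
      unfold TT
      rw [mul_add, mul_one, Finset.sum_range_add]
      congr 1
      refine Finset.sum_congr rfl fun j _ => ?_
      rw [pow_add, pow_mul, pow_fix hy]
    rw [this, ih]; push_cast; ring

lemma TT_pow {y : Om} {M : ℕ} (hy : y ^ (2 ^ M) = y) (k : ℕ) :
    TT M (y ^ (2 ^ k)) = TT M y := by
  induction k with
  | zero => simp
  | succ k ih =>
    rw [← ih]
    have hz : (y ^ (2 ^ k)) ^ (2 ^ M) = y ^ (2 ^ k) := by
      rw [← pow_mul, mul_comm, pow_mul, hy]
    rw [pow_succ, pow_mul]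
    generalize y ^ (2 ^ k) = z at *
    unfold TT
    have h1 := Finset.sum_range_succ (fun j => z ^ (2 ^ j)) M
    rw [Finset.sum_range_succ', hz] at h1
    simp only [pow_zero, pow_one, add_left_inj] at h1
    rw [← h1]
    refine Finset.sum_congr rfl fun j _ => ?_
    rw [← pow_mul, pow_succ, mul_comm]

lemma TT_sum {ι : Type*} (s : Finset ι) (f : ι → Om) (M : ℕ) :
    TT M (∑ i ∈ s, f i) = ∑ i ∈ s, TT M (f i) := by
  unfold TT
  rw [Finset.sum_comm]
  refine Finset.sum_congr rfl fun j _ => ?_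
  rw [sum_pow_char_pow]

lemma TT_sq (y : Om) (M : ℕ) : TT M (y ^ 2) = (TT M y) ^ 2 := by
  unfold TT
  rw [sum_pow_char]
  refine Finset.sum_congr rfl fun j _ => ?_
  rw [← pow_mul, ← pow_mul, mul_comm]

lemma qq_fix (S : Finset ℕ) {x : Om} {M : ℕ} (hx : x ^ (2 ^ M) = x) :
    (qq S x) ^ (2 ^ M) = qq S x := by
  unfold qq
  rw [sum_pow_char_pow]
  refine Finset.sum_congr rfl fun j _ => ?_
  rw [← pow_mul, mul_comm, pow_mul, hx]

lemma BO_one (S : Finset ℕ) (N : ℕ) (hodd : Odd S.card) : BO S N 1 := by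
  refine ⟨1, by simp, ?_, ?_⟩
  · unfold LL
    refine Finset.sum_eq_zero fun i _ => ?_
    rw [one_pow, one_pow, one_add_one_eq_two, om_two]
  · obtain ⟨k, hk⟩ := hodd
    simp [TT, qq, hk, om_two]

lemma upper (S : Finset ℕ) (N : ℕ) (hS : S.Nonempty) (hpos : ∀ i ∈ S, 1 ≤ i) (e d : ℕ)
    (hed : e < d) (hv : (ell S N).rootMultiplicity 1 ≤ 2 ^ e) : ¬ BO S N (2 ^ d) := by
  rintro ⟨x, hx, hL, hT⟩
  obtain ⟨g, hg, hng⟩ := exists_eq_pow_rootMultiplicity_mul_and_not_dvd _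
    (ell_ne_zero S N hS hpos) 1
  set v := (ell S N).rootMultiplicity 1
  have hX : (X - C 1 : (ZMod 2)[X]) = X + 1 := by
    rw [sub_eq_add_neg, ← C_neg]; congr 1
  have hcop : IsCoprime ((X - C 1 : (ZMod 2)[X]) ^ (2 ^ d)) g := by
    apply IsCoprime.pow_left
    exact (irreducible_X_sub_C (1 : ZMod 2)).coprime_iff_not_dvd.2 hng
  obtain ⟨a, b, hab⟩ := hcop
  set h : ℕ → Om := fun k => x ^ (2 ^ k) with hh
  have h1 : aeval (sh Om) ((X - C 1 : (ZMod 2)[X]) ^ (2 ^ d)) h = 0 := by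
    rw [hX, X_add_one_pow]
    funext j
    simp only [map_add, map_pow, aeval_X, map_one, LinearMap.add_apply, Module.End.one_apply,
      Pi.add_apply, sh_pow, Pi.zero_apply, hh]
    rw [add_comm j, pow_add, pow_mul, hx, ← two_mul, om_two, zero_mul]
  have h2 : aeval (sh Om) (ell S N) h = 0 := by
    funext j
    rw [aeval_ell]
    have : (LL S N x) ^ (2 ^ j) = 0 := by rw [hL]; simp
    refine Eq.trans ?_ this
    unfold LL
    rw [sum_pow_char_pow]
    refine Finset.sum_congr rfl fun i _ => ?_
    rw [add_pow_char_pow, ← pow_mul, ← pow_mul, ← pow_add, ← pow_add, add_comm j, add_comm j]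
  have h3 : aeval (sh Om) ((X - C 1 : (ZMod 2)[X]) ^ (2 ^ e)) h = 0 := by
    have : (X - C 1 : (ZMod 2)[X]) ^ (2 ^ e) =
        ((X - C 1) ^ (2 ^ e) * a) * (X - C 1) ^ (2 ^ d) +
          ((X - C 1) ^ (2 ^ e - v) * b) * ell S N := by
      have h4 : (X - C 1 : (ZMod 2)[X]) ^ (2 ^ e) = (X - C 1) ^ (2 ^ e - v) * (X - C 1) ^ v := by
        rw [← pow_add, Nat.sub_add_cancel hv]
      rw [hg]
      calc (X - C 1 : (ZMod 2)[X]) ^ (2 ^ e) = (X - C 1) ^ (2 ^ e) * (a * (X - C 1) ^ (2 ^ d) + b * g) := by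
            rw [hab, mul_one]
        _ = (X - C 1) ^ (2 ^ e) * a * (X - C 1) ^ (2 ^ d) + ((X - C 1) ^ (2 ^ e)) * (b * g) := by ring
        _ = _ := by
          conv_lhs => rw [h4]
          conv_rhs => rw [h4]
          ring
    rw [this, map_add, map_mul, map_mul (aeval (sh Om)) _ (ell S N), LinearMap.add_apply,
      Module.End.mul_apply, Module.End.mul_apply, h1, h2]
    simp
  have h4 : x ^ (2 ^ (2 ^ e)) = x := by
    rw [hX, X_add_one_pow] at h3
    have h5 := congrFun h3 0
    simp only [map_add, map_pow, aeval_X, map_one, LinearMap.add_apply, Module.End.one_apply,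
      Pi.add_apply, sh_pow, Pi.zero_apply, hh, zero_add, pow_zero, pow_one] at h5
    exact CharTwo.add_eq_zero.1 h5
  apply hT
  rw [show 2 ^ d = 2 ^ e * 2 ^ (d - e) by rw [← pow_add]; congr 1; omega,
    TT_mul (qq_fix S h4)]
  rw [show d - e = (d - e - 1) + 1 by omega, pow_succ]
  push_cast
  rw [om_two]; simp

/-- embedding of the finite field -/
noncomputable def emb (n : ℕ) : GaloisField 2 n →ₐ[ZMod 2] Om := IsAlgClosed.lift

lemma gf_pow (n : ℕ) (hn : 1 ≤ n) (w : GaloisField 2 n) : w ^ (2 ^ n) = w := by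
  have := Fintype.ofFinite (GaloisField 2 n)
  have h := FiniteField.pow_card w
  rwa [← Nat.card_eq_fintype_card, GaloisField.card 2 n (by omega)] at h

lemma emb_tr (n : ℕ) (hn : 1 ≤ n) (y : GaloisField 2 n) :
    TT n (emb n y) = algebraMap (ZMod 2) Om (Algebra.trace (ZMod 2) (GaloisField 2 n) y) := by
  rw [← (emb n).commutes, FiniteField.algebraMap_trace_eq_sum_pow,
    GaloisField.finrank 2 (by omega), map_sum]
  unfold TT
  refine Finset.sum_congr rfl fun j _ => ?_
  simp

lemma emb_qq (S : Finset ℕ) (n : ℕ) (y : GaloisField 2 n) : qq S (emb n y) = emb n (qq S y) := by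
  simp [qq]

lemma emb_LL (S : Finset ℕ) (N n : ℕ) (y : GaloisField 2 n) :
    LL S N (emb n y) = emb n (LL S N y) := by
  simp [LL]

lemma emb_surj (n : ℕ) (hn : 1 ≤ n) (x : Om) (hx : x ^ (2 ^ n) = x) : ∃ y, emb n y = x := by
  classical
  have := Fintype.ofFinite (GaloisField 2 n)
  have hne : (X ^ (2 ^ n) - X : Om[X]) ≠ 0 :=
    FiniteField.X_pow_card_pow_sub_X_ne_zero _ (by omega) (by norm_num)
  have hdeg : (X ^ (2 ^ n) - X : Om[X]).natDegree = 2 ^ n :=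
    FiniteField.X_pow_card_pow_sub_X_natDegree_eq _ (by omega) (by norm_num)
  have hsub : Finset.univ.image (emb n) ⊆ (X ^ (2 ^ n) - X : Om[X]).roots.toFinset := by
    intro z hz
    obtain ⟨y, -, rfl⟩ := Finset.mem_image.1 hz
    rw [Multiset.mem_toFinset, mem_roots hne]
    simp [IsRoot, ← map_pow, gf_pow n hn]
  have heq := Finset.eq_of_subset_of_card_le hsub (by
    rw [Finset.card_image_of_injective _ (show Function.Injective (emb n) from (emb n).injective), Finset.card_univ,
      ← Nat.card_eq_fintype_card, GaloisField.card 2 n (by omega)]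
    exact (Multiset.toFinset_card_le _).trans ((card_roots' _).trans hdeg.le))
  have hxm : x ∈ (X ^ (2 ^ n) - X : Om[X]).roots.toFinset := by
    rw [Multiset.mem_toFinset, mem_roots hne]
    simp [IsRoot, hx]
  rw [← heq] at hxm
  obtain ⟨y, -, hy⟩ := Finset.mem_image.1 hxm
  exact ⟨y, hy⟩

lemma lower (S : Finset ℕ) (N : ℕ) (hN : ∀ i ∈ S, i ≤ N) (hpos : ∀ i ∈ S, 1 ≤ i)
    (hodd : Odd S.card) (e : ℕ) (hd : ((X : (ZMod 2)[X]) + 1) ^ (2 ^ e + 1) ∣ ell S N) :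
    BO S N (2 ^ e) := by
  rcases Nat.eq_zero_or_pos e with rfl | he
  · exact BO_one S N hodd
  have hcount := odd_count S N hN hpos hodd e hd
  have hd' : (X : (ZMod 2)[X]) ^ (2 ^ e) + 1 ∣ ell S N := by
    rw [← X_add_one_pow]
    exact (pow_dvd_pow _ (Nat.le_succ _)).trans hd
  have hMH : 2 ^ e = 2 ^ (e - 1) * 2 := by rw [← pow_succ]; congr 1; omega
  have hHpos : 0 < 2 ^ (e - 1) := by positivity
  set H := 2 ^ (e - 1)
  set M := 2 ^ e
  have hMpos : 0 < M := by omega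
  obtain ⟨x0, hx0⟩ := Algebra.trace_surjective (ZMod 2) (GaloisField 2 M) 1
  obtain ⟨x, hx, hT⟩ : ∃ x : Om, x ^ (2 ^ M) = x ∧ TT M x = 1 := by
    refine ⟨emb M x0, by rw [← map_pow, gf_pow M hMpos], ?_⟩
    rw [emb_tr M hMpos, hx0, map_one]
  have hkill : ∀ {A : Type} [AddCommGroup A] [Module (ZMod 2) A] (h : ℕ → A),
      (∀ a : A, a + a = 0) → (∀ k, h (k + M) = h k) → ∀ j,
      ∑ i ∈ S, (h (j + (N + i)) + h (j + (N - i))) = 0 := by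
    intro A _ _ h hA hh j
    refine kill S N _ hd' h ?_ j
    funext k
    simp only [map_add, map_pow, aeval_X, map_one, LinearMap.add_apply, Module.End.one_apply,
      Pi.add_apply, sh_pow, Pi.zero_apply]
    rw [hh, hA]
  have hA : ∀ a : Om, a + a = 0 := fun a => CharTwo.add_self_eq_zero a
  refine ⟨x, hx, ?_, ?_⟩
  · have := hkill (fun k => x ^ (2 ^ k)) hA (fun k => by
      rw [add_comm, pow_add, pow_mul, hx]) 0
    simpa [LL] using this
  · set g : ℕ → Om := fun i => TT M (x ^ (2 ^ i + 1)) with hg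
    have hfix : ∀ k, (x ^ k) ^ (2 ^ M) = x ^ k := by
      intro k
      rw [← pow_mul, mul_comm, pow_mul, hx]
    have hper : ∀ i k, g (i + M * k) = g i := by
      intro i k
      simp only [hg]
      rw [pow_succ, add_comm i, pow_add, pow_mul, pow_fix hx, ← pow_succ]
    have hneg : ∀ i k, i ≤ M * k → g (M * k - i) = g i := by
      intro i k hik
      simp only [hg]
      rw [← TT_pow (hfix _) i, pow_succ, mul_pow, ← pow_mul, ← pow_add 2, Nat.sub_add_cancel hik,
        pow_fix hx, pow_succ, mul_comm]
    have hg0 : g 0 = 1 := by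
      simp only [hg, pow_zero, one_add_one_eq_two]
      rw [TT_sq, hT, one_pow]
    have hgH : g H = 0 := by
      simp only [hg]
      rw [hMH, TT_mul, Nat.cast_ofNat, om_two, zero_mul]
      rw [pow_succ, mul_pow, ← pow_mul, ← pow_add 2, ← mul_two, ← hMH, hx, mul_comm]
    have hk := hkill (fun k => if 0 < k % M ∧ k % M < H then g k else 0) hA (fun k => by
      have := hper k 1
      rw [mul_one] at this
      simp only [Nat.add_mod_right, this]) (M * N - N)
    have hsum : ∑ i ∈ S, g i = ∑ i ∈ S, (if M ∣ i then 1 else 0 : Om) := by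
      refine Eq.trans ?_ ((congrArg
        (fun z => (∑ i ∈ S, (if M ∣ i then 1 else 0 : Om)) + z) hk).trans (add_zero _))
      rw [← Finset.sum_add_distrib]
      refine Finset.sum_congr rfl fun i hi => ?_
      have hiN := hN i hi
      have hMN : N ≤ M * N := Nat.le_mul_of_pos_left _ hMpos
      rw [show M * N - N + (N + i) = i + M * N by omega,
        show M * N - N + (N - i) = M * N - i by omega, hper, hneg i N (by omega),
        Nat.add_mul_mod_self_left]
      have hdm := Nat.div_add_mod i M
      have hlt := Nat.mod_lt i hMpos
      have hgr : g i = g (i % M) := by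
        conv_lhs => rw [← hdm, add_comm, hper]
      have hq : i / M ≤ M * (i / M) := Nat.le_mul_of_pos_left _ hMpos
      by_cases hr : i % M = 0
      · have hdv : M ∣ i := Nat.dvd_of_mod_eq_zero hr
        have h5 : (M * N - i) % M = 0 :=
          Nat.mod_eq_zero_of_dvd (Nat.dvd_sub (Dvd.intro _ rfl) hdv)
        rw [if_pos hdv, hr, h5, hgr, hr, hg0]
        simp
      · have hdv : ¬ M ∣ i := fun h => hr (Nat.mod_eq_zero_of_dvd h)
        have h5 : (M * N - i) % M = M - i % M := by
          have : M * N - i = (M - i % M) + M * (N - i / M - 1) := by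
            have h5 : M * (N - i / M - 1) = M * N - M * (i / M) - M := by
              rw [Nat.mul_sub, Nat.mul_sub, mul_one]
            have h6 : M * (i / M + 1) ≤ M * N := Nat.mul_le_mul_left _ (by omega)
            rw [mul_add] at h6
            omega
          rw [this, Nat.add_mul_mod_self_left, Nat.mod_eq_of_lt (by omega)]
        rw [if_neg hdv, h5]
        rcases lt_trichotomy (i % M) H with h6 | h6 | h6
        · rw [if_pos (by omega), if_neg (by omega)]; simp
        · rw [if_neg (by omega), if_neg (by omega), hgr, h6, hgH]; simp
        · rw [if_neg (by omega), if_pos (by omega)]; simp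
    unfold qq
    rw [TT_sum, hsum, Finset.sum_boole]
    have h9 := congrArg (algebraMap (ZMod 2) Om) hcount
    rw [map_natCast, map_one] at h9
    rw [h9]
    exact one_ne_zero

lemma balanced_gf (S : Finset ℕ) (N : ℕ) (hN : ∀ i ∈ S, i ≤ N) (n : ℕ) (hn : 1 ≤ n) :
    BalancedG n (Qtr S n) ↔ ∃ w : GaloisField 2 n, LL S N w = 0 ∧
      Algebra.trace (ZMod 2) (GaloisField 2 n) (qq S w) = 1 := by
  have := Fintype.ofFinite (GaloisField 2 n)
  let B : GaloisField 2 n → GaloisField 2 n →+ ZMod 2 := fun w =>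
    { toFun := fun y => Algebra.trace (ZMod 2) _ (LL S N w * y ^ (2 ^ N))
      map_zero' := by simp
      map_add' := by
        intro a b
        rw [add_pow_char_pow, mul_add, map_add] }
  have h := balanced_iff (Qtr S n) B (fun w x => polar S N hN w x)
  have h2 : BalancedG n (Qtr S n) ↔ ∑ x, chi (Qtr S n x) = 0 := by
    rw [sum_chi, ← Nat.card_eq_fintype_card, GaloisField.card 2 n (by omega)]
    unfold BalancedG
    have : 2 ^ n = 2 * 2 ^ (n - 1) := by rw [← pow_succ']; congr 1; omega
    rw [this]
    push_cast
    constructor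
    · intro h; rw [h]; push_cast; ring
    · intro h
      have h3 : (Nat.card {x // Qtr S n x = 1} : ℤ) = 2 ^ (n - 1) := by linarith
      exact_mod_cast h3
  rw [h2, h]
  refine exists_congr fun w => and_congr (rad_iff S N w) Iff.rfl

lemma transfer (S : Finset ℕ) (N : ℕ) (hN : ∀ i ∈ S, i ≤ N) (n M m : ℕ) (hn : 1 ≤ n)
    (hnm : n = M * m) (hm : Odd m) : BalancedG n (Qtr S n) ↔ BO S N M := by
  rw [balanced_gf S N hN n hn]
  have hmO : (m : Om) = 1 := by
    obtain ⟨k, rfl⟩ := hm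
    simp [om_two]
  constructor
  · rintro ⟨w, hw, hq⟩
    obtain ⟨h1, h2⟩ := descend S N hN M m w hw
    have h3 := descend_fix M m w (by rw [← hnm]; exact gf_pow n hn w)
    generalize (∑ j ∈ Finset.range m, w ^ (2 ^ (M * j))) = z at *
    have hfix : (emb n z) ^ (2 ^ M) = emb n z := by rw [← map_pow, h3]
    refine ⟨emb n z, hfix, ?_, ?_⟩
    · rw [emb_LL, h1, map_zero]
    · have h4 := TT_mul (qq_fix S hfix) m
      rw [hmO, one_mul, ← hnm] at h4
      rw [← h4, emb_qq, emb_tr n hn, h2, hq, mul_one, map_natCast, hmO]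
      exact one_ne_zero
  · rintro ⟨x, hx, hL, hT⟩
    have hxn : x ^ (2 ^ n) = x := by rw [hnm]; exact pow_fix hx m
    obtain ⟨y, rfl⟩ := emb_surj n hn x hxn
    refine ⟨y, ?_, ?_⟩
    · rw [emb_LL] at hL
      exact (map_eq_zero (emb n)).1 hL
    · have h4 := TT_mul (qq_fix S hx) m
      rw [hmO, one_mul, ← hnm] at h4
      rw [← h4, emb_qq, emb_tr n hn] at hT
      have h5 : Algebra.trace (ZMod 2) (GaloisField 2 n) (qq S y) ≠ 0 := by
        intro h; rw [h, map_zero] at hT; exact hT rfl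
      revert h5
      generalize Algebra.trace (ZMod 2) (GaloisField 2 n) (qq S y) = a
      revert a; decide

end closure

/-- For an odd number of terms, `Q_n` is balanced exactly off the multiples of some
power of two `2^c`. -/
theorem odd_terms_balanced_iff_pow_not_dvd (S : Finset ℕ) (hS : S.Nonempty)
    (hpos : ∀ i ∈ S, 1 ≤ i) (hodd : Odd S.card) :
    ∃ c : ℕ, 1 ≤ c ∧ ∀ n, 1 ≤ n → (BalancedG n (Qtr S n) ↔ ¬ (2 ^ c ∣ n)) := by
  obtain ⟨N, hN⟩ : ∃ N, ∀ i ∈ S, i ≤ N := ⟨S.sup id, fun i hi => Finset.le_sup (f := id) hi⟩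
  set v := (ell S N).rootMultiplicity 1 with hv
  have hX : (X - C 1 : (ZMod 2)[X]) = X + 1 := by
    rw [sub_eq_add_neg, ← C_neg]; congr 1
  have hlow : ∀ e, 2 ^ e < v → BO S N (2 ^ e) := by
    intro e he
    refine lower S N hN hpos hodd e ?_
    rw [← hX]
    exact (pow_dvd_pow _ he).trans (pow_rootMultiplicity_dvd _ _)
  have hex : ∃ f, v ≤ 2 ^ f := ⟨v, Nat.lt_two_pow_self.le⟩
  classical
  have hf := Nat.find_spec hex
  have hmin : ∀ e, e < Nat.find hex → 2 ^ e < v := fun e he => not_le.1 (Nat.find_min hex he)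
  set f := Nat.find hex
  have hup : ∀ d, f < d → ¬ BO S N (2 ^ d) := fun d hd => upper S N hS hpos f d hd hf
  obtain ⟨c, hc1, hc⟩ : ∃ c : ℕ, 1 ≤ c ∧ ∀ e, BO S N (2 ^ e) ↔ e < c := by
    by_cases hB : BO S N (2 ^ f)
    · refine ⟨f + 1, by omega, fun e => ⟨fun h => ?_, fun h => ?_⟩⟩
      · by_contra hlt
        exact hup e (by omega) h
      · rcases Nat.lt_or_ge e f with h1 | h1
        · exact hlow e (hmin e h1)
        · rwa [show e = f by omega]
    · refine ⟨f, ?_, fun e => ⟨fun h => ?_, fun h => hlow e (hmin e h)⟩⟩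
      · by_contra h0
        apply hB
        rw [show f = 0 by omega]
        exact BO_one S N hodd
      · by_contra hlt
        rcases Nat.lt_or_ge f e with h1 | h1
        · exact hup e h1 h
        · exact hB (by rwa [show f = e by omega])
  refine ⟨c, hc1, fun n hn => ?_⟩
  obtain ⟨e, m, hm, hnm⟩ := Nat.exists_eq_two_pow_mul_odd (n := n) (by omega)
  rw [transfer S N hN n (2 ^ e) m hn hnm hm, hc, ← not_le, not_iff_not, hnm]
  symm
  constructor
  · intro h
    have h1 : 2 ^ c ∣ 2 ^ e := by
      apply Nat.Coprime.dvd_of_dvd_mul_right _ h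
      exact Nat.Coprime.pow_left _ (Nat.coprime_two_left.2 hm)
    exact (Nat.pow_dvd_pow_iff_le_right (by norm_num)).1 h1
  · intro h
    exact (pow_dvd_pow 2 h).mul_right m
end

section
/- Let S be a nonempty finite set of positive integers and let n ≥ 1 satisfy ν(n) ≤ ν(i) for every i ∈ S, where ν denotes the 2-adic valuation. Then the quadratic trace function Q_n(x) = Tr(∑_{i∈S} x^(2^i+1)) on GaloisField 2 n is balanced if and only if |S| is odd. -/
/-- the sign character -/
def chiS (c : ZMod 2) : ℤ := if c = 0 then 1 else -1

lemma chiS_add (a b : ZMod 2) : chiS (a + b) = chiS a * chiS b := by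
  revert a b; decide

lemma chiS_sum_zero {V : Type*} [AddCommGroup V] [Fintype V] (g : V → ZMod 2) (k : V)
    (h : ∀ x, g (x + k) = g x + 1) : ∑ x, chiS (g x) = 0 := by
  have h1 : ∑ x, chiS (g (x + k)) = ∑ x, chiS (g x) :=
    Equiv.sum_comp (Equiv.addRight k) (fun x => chiS (g x))
  have h2 : ∑ x, chiS (g (x + k)) = - ∑ x, chiS (g x) := by
    rw [← Finset.sum_neg_distrib]
    refine Finset.sum_congr rfl fun x _ => ?_
    rw [h, chiS_add]
    simp [chiS]
  omega

lemma chiS_sq {V : Type*} [AddCommGroup V] [Fintype V] (Q : V → ZMod 2) (B : V → V → ZMod 2)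
    (hB : ∀ x y, Q (x + y) = Q x + Q y + B x y)
    (hadd : ∀ x x' y, B (x + x') y = B x y + B x' y)
    (hrad : ∀ y, (∀ x, B x y = 0) → Q y = 0) : ∑ x, chiS (Q x) ≠ 0 := by
  classical
  have key : (∑ x, chiS (Q x)) * (∑ x, chiS (Q x)) =
      ∑ y, chiS (Q y) * ∑ x, chiS (B x y) := by
    rw [Finset.sum_mul]
    have : ∀ x, chiS (Q x) * ∑ z, chiS (Q z) = ∑ y, chiS (Q y) * chiS (B x y) := by
      intro x
      rw [← Equiv.sum_comp (Equiv.addLeft x) (fun z => chiS (Q z)), Finset.mul_sum]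
      refine Finset.sum_congr rfl fun y _ => ?_
      simp only [Equiv.coe_addLeft]
      rw [hB, ← chiS_add, ← chiS_add]
      congr 1
      generalize Q x = a; generalize Q y = b; generalize B x y = c
      revert a b c; decide
    simp_rw [this]
    rw [Finset.sum_comm]
    simp_rw [Finset.mul_sum]
  have hnn : ∀ y, 0 ≤ chiS (Q y) * ∑ x, chiS (B x y) := by
    intro y
    by_cases hy : ∀ x, B x y = 0
    · rw [hrad y hy]; simp [hy, chiS]
    · push Not at hy
      obtain ⟨k, hk⟩ := hy
      have hk1 : B k y = 1 := by
        revert hk; generalize B k y = a; revert a; decide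
      rw [chiS_sum_zero (fun x => B x y) k (fun x => by rw [hadd, hk1])]
      simp
  have h00 : ∀ x, B x 0 = 0 := by
    intro x
    have h1 := hB x 0
    have h2 := hB 0 0
    have h3 := hadd 0 0 0
    simp at h1 h2 h3
    rw [h3] at h2
    have : Q 0 = 0 := by simpa using h2
    rw [this] at h1
    simpa using h1
  have hpos0 : 0 < ∑ y, chiS (Q y) * ∑ x, chiS (B x y) := by
    refine Finset.sum_pos' (fun y _ => hnn y) ⟨0, Finset.mem_univ _, ?_⟩
    rw [hrad 0 h00]
    simp only [h00]
    simp [chiS, Fintype.card_pos]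
  intro h
  rw [← key, h] at hpos0
  simp at hpos0

lemma balanced_iff_chiS (n : ℕ) (hn : 1 ≤ n) [Fintype (GaloisField 2 n)]
    (g : GaloisField 2 n → ZMod 2) :
    BalancedG n g ↔ ∑ x, chiS (g x) = 0 := by
  classical
  unfold BalancedG
  have hc : Fintype.card (GaloisField 2 n) = 2 ^ n := by
    rw [← Nat.card_eq_fintype_card, GaloisField.card 2 n (by omega)]
  have h1 : ∀ x, chiS (g x) = 1 - 2 * (if g x = 1 then 1 else 0) := by
    intro x; generalize g x = a; revert a; decide
  simp_rw [h1]
  rw [Finset.sum_sub_distrib, ← Finset.mul_sum, Finset.sum_boole, Nat.card_eq_fintype_card,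
    Fintype.card_subtype]
  simp only [Finset.sum_const, Finset.card_univ, hc]
  obtain ⟨k, rfl⟩ : ∃ k, n = k + 1 := ⟨n - 1, by omega⟩
  simp only [Nat.add_sub_cancel, pow_succ]
  zify
  simp only [nsmul_eq_mul]
  push_cast
  constructor <;> intro h <;> linarith

section
variable {n : ℕ}

lemma tr_sq_s13 (x : GaloisField 2 n) :
    Algebra.trace (ZMod 2) (GaloisField 2 n) (x ^ 2) =
      Algebra.trace (ZMod 2) (GaloisField 2 n) x := by
  have := Algebra.trace_eq_of_algEquiv
    (FiniteField.frobeniusAlgEquivOfAlgebraic (ZMod 2) (GaloisField 2 n)) x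
  simpa [FiniteField.coe_frobeniusAlgEquivOfAlgebraic, ZMod.card] using this

lemma tr_pow_s13 (k : ℕ) (x : GaloisField 2 n) :
    Algebra.trace (ZMod 2) (GaloisField 2 n) (x ^ 2 ^ k) =
      Algebra.trace (ZMod 2) (GaloisField 2 n) x := by
  induction k with
  | zero => simp
  | succ k ih => rw [pow_succ, pow_mul, tr_sq_s13, ih]

/-- polar form -/
noncomputable def Bpol (S : Finset ℕ) (n : ℕ) (x y : GaloisField 2 n) : ZMod 2 :=
  Algebra.trace (ZMod 2) (GaloisField 2 n) (∑ i ∈ S, (x ^ 2 ^ i * y + x * y ^ 2 ^ i))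

lemma Q_add (S : Finset ℕ) (x y : GaloisField 2 n) :
    Qtr S n (x + y) = Qtr S n x + Qtr S n y + Bpol S n x y := by
  unfold Qtr Bpol
  rw [← map_add, ← map_add, ← Finset.sum_add_distrib, ← Finset.sum_add_distrib]
  congr 1
  refine Finset.sum_congr rfl fun i _ => ?_
  rw [pow_succ, add_pow_char_pow]
  ring

lemma B_add (S : Finset ℕ) (x x' y : GaloisField 2 n) :
    Bpol S n (x + x') y = Bpol S n x y + Bpol S n x' y := by
  unfold Bpol
  rw [← map_add, ← Finset.sum_add_distrib]
  congr 1
  refine Finset.sum_congr rfl fun i _ => ?_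
  rw [add_pow_char_pow]
  ring

lemma Q_pow (S : Finset ℕ) (k : ℕ) (x : GaloisField 2 n) :
    Qtr S n (x ^ 2 ^ k) = Qtr S n x := by
  unfold Qtr
  rw [← tr_pow_s13 k (∑ i ∈ S, x ^ (2 ^ i + 1)), sum_pow_char_pow]
  congr 1
  refine Finset.sum_congr rfl fun i _ => ?_
  rw [← pow_mul, ← pow_mul, mul_comm]

lemma B_pow (S : Finset ℕ) (k : ℕ) (x y : GaloisField 2 n) :
    Bpol S n (x ^ 2 ^ k) (y ^ 2 ^ k) = Bpol S n x y := by
  have h := Q_add S (x ^ 2 ^ k) (y ^ 2 ^ k)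
  rw [← add_pow_char_pow, Q_pow, Q_pow, Q_pow, Q_add] at h
  exact (add_left_cancel h).symm

lemma rad_pow (S : Finset ℕ) (k : ℕ) (y : GaloisField 2 n) (hy : ∀ x, Bpol S n x y = 0) :
    ∀ x, Bpol S n x (y ^ 2 ^ k) = 0 := by
  intro x
  obtain ⟨z, rfl⟩ : ∃ z : GaloisField 2 n, z ^ 2 ^ k = x := by
    have := (bijective_iterateFrobenius (GaloisField 2 n) 2 k).2 x
    simpa [iterateFrobenius_def] using this
  rw [B_pow, hy]

/-- relative trace -/
noncomputable def relT (n a m : ℕ) (x : GaloisField 2 n) : GaloisField 2 n :=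
  ∑ k ∈ Finset.range m, x ^ 2 ^ (a * k)

lemma relT_fix (a m : ℕ) (hn : n = a * m) (h0 : n ≠ 0) (x : GaloisField 2 n) :
    (relT n a m x) ^ 2 ^ a = relT n a m x := by
  unfold relT
  have hx : x ^ 2 ^ (a * m) = x := by
    rw [← hn]
    have : Fintype (GaloisField 2 n) := Fintype.ofFinite _
    have hc : Fintype.card (GaloisField 2 n) = 2 ^ n := by
      rw [← Nat.card_eq_fintype_card, GaloisField.card 2 n h0]
    rw [← hc, FiniteField.pow_card]
  rw [sum_pow_char_pow]
  have h1 : ∀ k, (x ^ 2 ^ (a * k)) ^ 2 ^ a = x ^ 2 ^ (a * (k + 1)) := by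
    intro k; rw [← pow_mul, ← pow_add]; rfl
  simp_rw [h1]
  have h2 := Finset.sum_range_succ (fun k => x ^ 2 ^ (a * k)) m
  rw [Finset.sum_range_succ'] at h2
  simp only [hx, mul_zero, pow_zero, pow_one] at h2
  exact add_right_cancel h2

lemma fix_pow (a j : ℕ) (y : GaloisField 2 n) (hy : y ^ 2 ^ a = y) : y ^ 2 ^ (a * j) = y := by
  induction j with
  | zero => simp
  | succ j ih => rw [mul_add, pow_add, pow_mul, ih, mul_one, hy]

lemma Q_sum_rad (S : Finset ℕ) (f : ℕ → GaloisField 2 n)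
    (hf : ∀ k x, Bpol S n x (f k) = 0) (m : ℕ) :
    Qtr S n (∑ k ∈ Finset.range m, f k) = ∑ k ∈ Finset.range m, Qtr S n (f k) := by
  induction m with
  | zero => simp [Qtr]
  | succ m ih => rw [Finset.sum_range_succ, Q_add, hf, ih, Finset.sum_range_succ, add_zero]

lemma Q_fix (S : Finset ℕ) (y : GaloisField 2 n) (hy : ∀ i ∈ S, y ^ 2 ^ i = y) :
    Qtr S n y = S.card * Algebra.trace (ZMod 2) (GaloisField 2 n) y := by
  unfold Qtr
  rw [map_sum, Finset.sum_congr rfl (g := fun _ => Algebra.trace (ZMod 2) (GaloisField 2 n) y)]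
  · simp
  · intro i hi
    rw [pow_succ, hy i hi, ← sq, tr_sq_s13]

lemma B_fix (S : Finset ℕ) (y : GaloisField 2 n) (hy : ∀ i ∈ S, y ^ 2 ^ i = y)
    (x : GaloisField 2 n) : Bpol S n x y = 0 := by
  unfold Bpol
  rw [map_sum]
  refine Finset.sum_eq_zero fun i hi => ?_
  have : x ^ 2 ^ i * y = (x * y) ^ 2 ^ i := by rw [mul_pow, hy i hi]
  rw [map_add, this, tr_pow_s13, hy i hi]
  exact CharTwo.add_self_eq_zero _

end

/-- If `ν(n) ≤ ν(i)` for every `i ∈ S`, then `Q_n` is balanced iff `S` has an odd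
number of elements. -/
theorem low_valuation_balanced_iff_odd (S : Finset ℕ) (hS : S.Nonempty)
    (hpos : ∀ i ∈ S, 1 ≤ i) (n : ℕ) (hn : 1 ≤ n)
    (hval : ∀ i ∈ S, padicValNat 2 n ≤ padicValNat 2 i) :
    BalancedG n (Qtr S n) ↔ Odd S.card := by
  have : Fintype (GaloisField 2 n) := Fintype.ofFinite _
  rw [balanced_iff_chiS n hn]
  have h0 : n ≠ 0 := by omega
  obtain ⟨m, hm⟩ : 2 ^ padicValNat 2 n ∣ n := pow_padicValNat_dvd
  set a := 2 ^ padicValNat 2 n with ha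
  have hmodd : Odd m := by
    by_contra hme
    rw [Nat.not_odd_iff_even] at hme
    obtain ⟨c, hc⟩ := hme.two_dvd
    apply pow_succ_padicValNat_not_dvd (p := 2) h0
    refine ⟨c, ?_⟩
    rw [pow_succ, ← ha, mul_assoc, ← hc]
    exact hm
  have hm1 : (m : ZMod 2) = 1 := (ZMod.natCast_eq_one_iff_odd).2 hmodd
  have hdiv : ∀ i ∈ S, a ∣ i := fun i hi =>
    (pow_dvd_pow 2 (hval i hi)).trans pow_padicValNat_dvd
  have hfix : ∀ x : GaloisField 2 n, ∀ i ∈ S, (relT n a m x) ^ 2 ^ i = relT n a m x := by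
    intro x i hi
    obtain ⟨j, rfl⟩ := hdiv i hi
    exact fix_pow a j _ (relT_fix a m hm h0 x)
  constructor
  · intro h
    by_contra hodd
    rw [Nat.not_odd_iff_even] at hodd
    refine chiS_sq (Qtr S n) (Bpol S n) (Q_add S) (B_add S) ?_ h
    intro y hy
    have h1 : Qtr S n (relT n a m y) = Qtr S n y := by
      unfold relT
      rw [Q_sum_rad S _ (fun k x => rad_pow S (a * k) y hy x)]
      simp [Q_pow, hm1]
    rw [← h1, Q_fix S _ (hfix y), (ZMod.natCast_eq_zero_iff_even).2 hodd, zero_mul]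
  · intro hodd
    obtain ⟨x0, hx0⟩ := Algebra.trace_surjective (ZMod 2) (GaloisField 2 n) 1
    refine chiS_sum_zero (Qtr S n) (relT n a m x0) fun x => ?_
    have ht : Algebra.trace (ZMod 2) (GaloisField 2 n) (relT n a m x0) = 1 := by
      unfold relT
      simp [map_sum, tr_pow_s13, hx0, hm1]
    rw [Q_add, B_fix S _ (hfix x0), Q_fix S _ (hfix x0), ht,
      (ZMod.natCast_eq_one_iff_odd).2 hodd]
    simp
end
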